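/- arXiv:2512.13535 — 2 statements merged into one kernel-verified Lean document; each statement's English description precedes it below -/
import Mathlib

section
/- Let d ≥ 1 and let u : ℝ^d → ℝ be three times continuously differentiable. Let x ∈ ℝ^d be a point where ∇u(x) ≠ 0. Then the function y ↦ ‖∇u(y)‖ is twice continuously differentiable in a neighborhood of x, and Δ(‖∇u‖)(x) ≥ (∇u(x)/‖∇u(x)‖) · ∇(Δu)(x). -/
open MeasureTheory Real
open scoped RealInnerProductSpace

noncomputable section

/-- `d`-dimensional Euclidean space. -/
abbrev Euc (d : ℕ) := EuclideanSpace ℝ (Fin d)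

/-- Divergence of a vector field on `ℝ^d`. -/
def diverg {d : ℕ} (V : Euc d → Euc d) (x : Euc d) : ℝ :=
  ∑ i, ⟪fderiv ℝ V x (EuclideanSpace.single i 1), EuclideanSpace.single i (1:ℝ)⟫

/-- Laplacian of a scalar function on `ℝ^d`. -/
def lap {d : ℕ} (u : Euc d → ℝ) (x : Euc d) : ℝ :=
  ∑ i, fderiv ℝ (fun y => fderiv ℝ u y (EuclideanSpace.single i 1)) x
    (EuclideanSpace.single i 1)

/-- Kato's inequality in a fixed direction, for a vector-valued function. -/
theorem inner_second_fderiv_le_norm_mul {E F : Type*} [NormedAddCommGroup E] [NormedSpace ℝ E]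
    [NormedAddCommGroup F] [InnerProductSpace ℝ F] {f : E → F} (hf : ContDiff ℝ 2 f)
    {x : E} (hx : f x ≠ 0) (v : E) :
    ⟪f x, fderiv ℝ (fun y => fderiv ℝ f y v) x v⟫ ≤
      ‖f x‖ * fderiv ℝ (fun y => fderiv ℝ (fun z => ‖f z‖) y v) x v := by
  have hd : Differentiable ℝ f := hf.differentiable (by norm_num)
  have hw : ContDiffAt ℝ 2 (fun y => ‖f y‖) x := hf.contDiffAt.norm ℝ hx
  have hfirst : ∀ y, f y ≠ 0 →
      ‖f y‖ * fderiv ℝ (fun z => ‖f z‖) y v = ⟪f y, fderiv ℝ f y v⟫ := by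
    intro y hy
    have hn : DifferentiableAt ℝ (fun z => ‖f z‖) y := (hd y).norm ℝ hy
    have h1 := (hn.hasFDerivAt.mul hn.hasFDerivAt).unique
      (((hd y).hasFDerivAt.inner ℝ (hd y).hasFDerivAt).congr_of_eventuallyEq
        (Filter.Eventually.of_forall fun z => (real_inner_self_eq_norm_mul_norm (f z)).symm))
    have h2 := congrArg (fun L : E →L[ℝ] ℝ => L v) h1
    simp [fderivInnerCLM_apply, real_inner_comm] at h2
    linarith
  have hne : ∀ᶠ y in nhds x, f y ≠ 0 := hd.continuous.continuousAt.eventually_ne hx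
  have hf' : DifferentiableAt ℝ (fun y => fderiv ℝ f y v) x :=
    (((hf.fderiv_right (m := 1) (by norm_num)).differentiable (by norm_num)) x).clm_apply
      (differentiableAt_const v)
  have hw' : DifferentiableAt ℝ (fun y => fderiv ℝ (fun z => ‖f z‖) y v) x :=
    ((hw.fderiv_right (m := 1) (by norm_num)).differentiableAt (by norm_num)).clm_apply
      (differentiableAt_const v)
  have hsecond := congrArg (fun L : E →L[ℝ] ℝ => L v)
    (((((hd x).norm ℝ hx).hasFDerivAt).mul hw'.hasFDerivAt).unique
      (((hd x).hasFDerivAt.inner ℝ hf'.hasFDerivAt).congr_of_eventuallyEq (hne.mono hfirst)))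
  simp [fderivInnerCLM_apply] at hsecond
  have hle : |fderiv ℝ (fun z => ‖f z‖) x v| ≤ ‖fderiv ℝ f x v‖ := by
    have hpos : 0 < ‖f x‖ := norm_pos_iff.mpr hx
    refine le_of_mul_le_mul_left ?_ hpos
    calc ‖f x‖ * |fderiv ℝ (fun z => ‖f z‖) x v|
        = |⟪f x, fderiv ℝ f x v⟫| := by rw [← hfirst x hx, abs_mul, abs_norm]
      _ ≤ _ := abs_real_inner_le_norm _ _
  have hsq := sq_le_sq' (abs_le.mp hle).1 (abs_le.mp hle).2
  nlinarith

theorem fderiv_fderiv_apply_comm {E : Type*} [NormedAddCommGroup E] [NormedSpace ℝ E]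
    {f : E → ℝ} (hf : ContDiff ℝ 2 f) (x a b : E) :
    fderiv ℝ (fun y => fderiv ℝ f y a) x b = fderiv ℝ (fun y => fderiv ℝ f y b) x a := by
  have hd : DifferentiableAt ℝ (fderiv ℝ f) x :=
    ((hf.fderiv_right (m := 1) (by norm_num)).differentiable (by norm_num)) x
  have key : ∀ c e, fderiv ℝ (fun y => fderiv ℝ f y c) x e = fderiv ℝ (fderiv ℝ f) x e c := by
    intro c e
    rw [fderiv_clm_apply hd (differentiableAt_const c)]
    simp
  rw [key, key]
  exact (hf.contDiffAt.isSymmSndFDerivAt (by simp)).eq b a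

theorem ContDiff.fderiv_apply_const {E F : Type*} [NormedAddCommGroup E] [NormedSpace ℝ E]
    [NormedAddCommGroup F] [NormedSpace ℝ F] {f : E → F} {m n : WithTop ℕ∞}
    (hf : ContDiff ℝ n f) (hmn : m + 1 ≤ n) (v : E) :
    ContDiff ℝ m (fun y => fderiv ℝ f y v) :=
  (hf.fderiv_right hmn).clm_apply contDiff_const

theorem ContDiff.gradient_of_succ_le {E : Type*} [NormedAddCommGroup E] [InnerProductSpace ℝ E]
    [CompleteSpace E] {u : E → ℝ} {m n : WithTop ℕ∞} (hu : ContDiff ℝ n u) (hmn : m + 1 ≤ n) :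
    ContDiff ℝ m (gradient u) :=
  (InnerProductSpace.toDual ℝ E).symm.contDiff.comp (hu.fderiv_right hmn)

theorem fderiv_inner_const_left_apply {E F : Type*} [NormedAddCommGroup E] [NormedSpace ℝ E]
    [NormedAddCommGroup F] [InnerProductSpace ℝ F] {f : E → F} {x : E}
    (hf : DifferentiableAt ℝ f x) (n : F) (v : E) :
    fderiv ℝ (fun y => ⟪n, f y⟫) x v = ⟪n, fderiv ℝ f x v⟫ := by
  simp [fderiv_inner_apply ℝ (differentiableAt_const n) hf]

theorem inner_gradient_lap {d : ℕ} {u : Euc d → ℝ} (hu : ContDiff ℝ 3 u) (x n : Euc d) :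
    ⟪n, gradient (fun y => lap u y) x⟫ =
      ∑ i, ⟪n, fderiv ℝ (fun y => fderiv ℝ (gradient u) y (EuclideanSpace.single i 1)) x
        (EuclideanSpace.single i 1)⟫ := by
  have hG : ContDiff ℝ 2 (gradient u) := hu.gradient_of_succ_le (by norm_num)
  have hD : ∀ v, ContDiff ℝ 2 (fun y => fderiv ℝ u y v) := fun v =>
    hu.fderiv_apply_const (by norm_num) v
  rw [inner_gradient_right, conj_trivial]
  unfold lap
  rw [fderiv_fun_sum fun i _ => (((hD _).fderiv_apply_const (m := 1) (by norm_num) _).differentiable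
    (by norm_num)) x, _root_.sum_apply]
  refine Finset.sum_congr rfl fun i _ => ?_
  generalize EuclideanSpace.single i (1 : ℝ) = e
  have hGe : Differentiable ℝ (fun y => fderiv ℝ (gradient u) y e) :=
    (hG.fderiv_apply_const (m := 1) (by norm_num) e).differentiable (by norm_num)
  rw [fderiv_fderiv_apply_comm (hD e), ← fderiv_inner_const_left_apply (hGe x)]
  congr 2
  funext y
  rw [fderiv_fderiv_apply_comm (hu.of_le (by norm_num)),
    ← fderiv_inner_const_left_apply (hG.differentiable (by norm_num) y)]
  congr 2
  funext z
  rw [inner_gradient_right, conj_trivial]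

theorem stmt_7 (d : ℕ) (hd : 1 ≤ d) (u : Euc d → ℝ) (hu : ContDiff ℝ 3 u)
    (x : Euc d) (hx : gradient u x ≠ 0) :
    ContDiffAt ℝ 2 (fun y => ‖gradient u y‖) x ∧
    ⟪(‖gradient u x‖)⁻¹ • gradient u x, gradient (fun y => lap u y) x⟫ ≤
      lap (fun y => ‖gradient u y‖) x := by
  have hG : ContDiff ℝ 2 (gradient u) := hu.gradient_of_succ_le (by norm_num)
  refine ⟨hG.contDiffAt.norm ℝ hx, ?_⟩
  have hpos : 0 < ‖gradient u x‖ := norm_pos_iff.mpr hx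
  rw [inner_gradient_lap hu]
  refine Finset.sum_le_sum fun i _ => ?_
  rw [real_inner_smul_left, inv_mul_le_iff₀ hpos]
  exact inner_second_fderiv_le_norm_mul hG hx _
end
end

section
/- (Kruzhkov entropy inequality for classical viscous solutions.) Let d ≥ 1, T > 0, ε ≥ 0, k ∈ ℝ, and let f : ℝ → ℝ be continuously differentiable. Let W : (0,T) × ℝ^d → ℝ^d be continuous and continuously differentiable in the space variable, with div_x W continuous. Let u : (0,T) × ℝ^d → ℝ be continuously differentiable in t and twice continuously differentiable in x, with ∂_t u, ∇_x u, Δ_x u continuous, satisfying pointwise on (0,T)×ℝ^d: ∂_t u + f′(u)·∇_x u·W + f(u)·div_x W = ε·Δ_x u. Then for every φ : (0,T)×ℝ^d → ℝ twice continuously differentiable, compactly supported in (0,T)×ℝ^d, with φ ≥ 0: ∫_0^T∫_{ℝ^d} [ |u−k|·∂_t φ + sign(u−k)·(f(u)−f(k))·W·∇_x φ − sign(u−k)·f(k)·(div_x W)·φ + ε·|u−k|·Δ_x φ ] dx dt ≥ 0. -/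
open MeasureTheory Real
open scoped RealInnerProductSpace

noncomputable section

open Filter Topology

section CompactSupport

lemma continuous_of_continuousOn_of_eq_zero {X : Type*} [TopologicalSpace X] {O K : Set X}
    {h : X → ℝ} (hO : IsOpen O) (hK : IsClosed K) (hKO : K ⊆ O)
    (hc : ContinuousOn h O) (h0 : ∀ p ∉ K, h p = 0) : Continuous h := by
  refine hc.continuous_of_tsupport_subset hO (Set.Subset.trans ?_ hKO)
  refine closure_minimal (fun p hp => ?_) hK
  by_contra hpK
  exact hp (h0 p hpK)

lemma integrable_slice_left {Y Z : Type*} [TopologicalSpace Y] [TopologicalSpace Z] [R1Space Y]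
    [MeasurableSpace Y] [OpensMeasurableSpace Y] {μ : Measure Y} [IsFiniteMeasureOnCompacts μ]
    {K : Set (Y × Z)} {h : Y × Z → ℝ} (hK : IsCompact K)
    (hc : Continuous h) (h0 : ∀ p ∉ K, h p = 0) (z : Z) : Integrable (fun y => h (y, z)) μ := by
  refine (hc.comp (by fun_prop : Continuous fun y => (y, z))).integrable_of_hasCompactSupport ?_
  refine HasCompactSupport.intro (hK.image continuous_fst) fun y hy => h0 _ fun hyz => ?_
  exact hy ⟨_, hyz, rfl⟩

end CompactSupport

/-- A smooth increasing approximation of the sign function. -/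
def smoothSign (n : ℕ) (r : ℝ) : ℝ := 2 / π * arctan (n * r)

lemma contDiff_smoothSign (n : ℕ) : ContDiff ℝ 1 (smoothSign n) := by
  unfold smoothSign
  exact contDiff_const.mul (contDiff_arctan.comp (contDiff_const.mul contDiff_id))

lemma hasDerivAt_smoothSign (n : ℕ) (r : ℝ) :
    HasDerivAt (smoothSign n) (2 / π * (1 / (1 + (n * r) ^ 2) * n)) r := by
  unfold smoothSign
  have := ((hasDerivAt_id r).const_mul (n : ℝ)).arctan.const_mul (2 / π)
  simpa using this

lemma deriv_smoothSign_nonneg (n : ℕ) (r : ℝ) : 0 ≤ deriv (smoothSign n) r := by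
  rw [(hasDerivAt_smoothSign n r).deriv]
  positivity

lemma abs_smoothSign_le (n : ℕ) (r : ℝ) : |smoothSign n r| ≤ 1 := by
  have h : |arctan (n * r)| ≤ π / 2 :=
    abs_le.2 ⟨(neg_pi_div_two_lt_arctan _).le, (arctan_lt_pi_div_two _).le⟩
  rw [smoothSign, abs_mul, abs_of_pos (by positivity)]
  calc 2 / π * |arctan (n * r)| ≤ 2 / π * (π / 2) := by gcongr
    _ = 1 := by field_simp

lemma tendsto_smoothSign (r : ℝ) :
    Tendsto (fun n => smoothSign n r) atTop (𝓝 (Real.sign r)) := by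
  have hn : Tendsto (fun n : ℕ => (n : ℝ)) atTop atTop := tendsto_natCast_atTop_atTop
  rcases lt_trichotomy r 0 with hr | rfl | hr
  · have := ((tendsto_nhds_of_tendsto_nhdsWithin tendsto_arctan_atBot).comp
      (hn.atTop_mul_const_of_neg hr)).const_mul (2 / π)
    rw [Real.sign_of_neg hr, show (-1 : ℝ) = 2 / π * -(π / 2) by field_simp]
    exact this
  · simp [smoothSign]
  · have := ((tendsto_nhds_of_tendsto_nhdsWithin tendsto_arctan_atTop).comp
      (hn.atTop_mul_const hr)).const_mul (2 / π)
    rw [Real.sign_of_pos hr, show (1 : ℝ) = 2 / π * (π / 2) by field_simp]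
    exact this

lemma sign_mul_self_eq_abs (r : ℝ) : Real.sign r * r = |r| := by
  rcases lt_trichotomy r 0 with hr | rfl | hr
  · rw [Real.sign_of_neg hr, abs_of_neg hr, neg_one_mul]
  · simp
  · rw [Real.sign_of_pos hr, abs_of_pos hr, one_mul]

/-- The entropy flux with derivative `smoothSign n (· - k) * g` vanishing at `k`. -/
def smoothFlux (k : ℝ) (g : ℝ → ℝ) (n : ℕ) (r : ℝ) : ℝ :=
  ∫ s in k..r, smoothSign n (s - k) * g s

section Flux

variable (k : ℝ) {g : ℝ → ℝ}

lemma hasDerivAt_smoothFlux (hg : Continuous g) (n : ℕ) (r : ℝ) :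
    HasDerivAt (smoothFlux k g n) (smoothSign n (r - k) * g r) r := by
  have := (contDiff_smoothSign n).continuous
  exact intervalIntegral.integral_hasDerivAt_right
    (Continuous.intervalIntegrable (by fun_prop) _ _)
    (Continuous.stronglyMeasurableAtFilter (by fun_prop) _ _)
    (Continuous.continuousAt (by fun_prop))

lemma contDiff_smoothFlux (hg : Continuous g) (n : ℕ) : ContDiff ℝ 1 (smoothFlux k g n) := by
  have := (contDiff_smoothSign n).continuous
  refine contDiff_one_iff_deriv.2
    ⟨fun r => (hasDerivAt_smoothFlux k hg n r).differentiableAt, ?_⟩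
  rw [funext fun r => (hasDerivAt_smoothFlux k hg n r).deriv]
  fun_prop

lemma continuous_abs_primitive (hg : Continuous g) :
    Continuous fun r => |(∫ s in k..r, |g s|)| := by
  have h : Continuous fun s => |g s| := hg.abs
  exact (intervalIntegral.continuous_primitive (fun a b => h.intervalIntegrable a b) k).abs

lemma abs_smoothFlux_le (hg : Continuous g) (n : ℕ) (r : ℝ) :
    |smoothFlux k g n r| ≤ |(∫ s in k..r, |g s|)| := by
  have h : Continuous fun s => |g s| := hg.abs
  rw [← norm_eq_abs, smoothFlux]
  refine intervalIntegral.norm_integral_le_abs_of_norm_le (Eventually.of_forall fun s => ?_)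
    (h.intervalIntegrable _ _)
  rw [norm_eq_abs, abs_mul]
  exact mul_le_of_le_one_left (abs_nonneg _) (abs_smoothSign_le _ _)

lemma tendsto_smoothFlux (hg : Continuous g) (r : ℝ) :
    Tendsto (fun n => smoothFlux k g n r) atTop (𝓝 (Real.sign (r - k) * ∫ s in k..r, g s)) := by
  rw [← intervalIntegral.integral_const_mul]
  refine intervalIntegral.tendsto_integral_filter_of_dominated_convergence (fun s => |g s|)
    (Eventually.of_forall fun n => ?_) (Eventually.of_forall fun n => ?_)
    (Continuous.intervalIntegrable (by fun_prop) _ _) ?_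
  · have := (contDiff_smoothSign n).continuous
    exact Continuous.aestronglyMeasurable (by fun_prop)
  · refine Eventually.of_forall fun s _ => ?_
    rw [norm_eq_abs, abs_mul]
    exact mul_le_of_le_one_left (abs_nonneg _) (abs_smoothSign_le _ _)
  · filter_upwards [compl_mem_ae_iff.2 (measure_singleton (μ := volume) k)] with s hs hsr
    have hs : s ≠ k := hs
    have key : Real.sign (r - k) = Real.sign (s - k) := by
      rcases Set.mem_uIoc.1 hsr with h | h
      · rw [Real.sign_of_pos (by linarith), Real.sign_of_pos (by linarith)]
      · have := lt_of_le_of_ne h.2 hs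
        rw [Real.sign_of_neg (by linarith), Real.sign_of_neg (by linarith)]
    rw [key]
    exact (tendsto_smoothSign _).mul_const _

end Flux

section Space

variable {d : ℕ}

lemma integral_fderiv_apply_eq_zero {g : Euc d → ℝ} (hg : ContDiff ℝ 1 g)
    (hgc : HasCompactSupport g) (v : Euc d) : ∫ x, fderiv ℝ g x v = 0 := by
  have hg' : Continuous fun x => fderiv ℝ g x v :=
    (hg.continuous_fderiv one_ne_zero).clm_apply continuous_const
  have := integral_mul_fderiv_eq_neg_fderiv_mul_of_integrable (μ := (volume : Measure (Euc d)))
    (f := fun _ : Euc d => (1 : ℝ)) (g := g) (v := v) (by simp)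
    (by simpa using hg'.integrable_of_hasCompactSupport (hgc.fderiv_apply ℝ v))
    (by simpa using hg.continuous.integrable_of_hasCompactSupport hgc)
    (fun x _ => by fun_prop) (fun x _ => hg.differentiable one_ne_zero x)
  simpa using this

lemma inner_eq_sum_fderiv (v : Euc d → ℝ) (x V : Euc d) :
    ⟪gradient v x, V⟫ = ∑ i, fderiv ℝ v x (EuclideanSpace.single i 1) * V i := by
  rw [inner_gradient_left]
  conv_lhs => rw [← (EuclideanSpace.basisFun (Fin d) ℝ).sum_repr V]
  simp [mul_comm]

lemma diverg_eq_sum {V : Euc d → Euc d} {x : Euc d} (hV : DifferentiableAt ℝ V x) :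
    diverg V x = ∑ i, fderiv ℝ (fun y => V y i) x (EuclideanSpace.single i 1) := by
  refine Finset.sum_congr rfl fun i _ => ?_
  have := ((EuclideanSpace.proj i : Euc d →L[ℝ] ℝ).hasFDerivAt.comp x hV.hasFDerivAt).fderiv
  have h2 : fderiv ℝ (fun y => V y i) x = (EuclideanSpace.proj i).comp (fderiv ℝ V x) := this
  rw [h2]
  simp [EuclideanSpace.inner_single_right]

lemma integral_flux_eq_zero {v φ : Euc d → ℝ} {V : Euc d → Euc d} {Q Q' : ℝ → ℝ}
    (hv : ContDiff ℝ 1 v) (hφ : ContDiff ℝ 1 φ) (hφc : HasCompactSupport φ)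
    (hV : ContDiff ℝ 1 V) (hQ : ContDiff ℝ 1 Q) (hQ' : ∀ r, HasDerivAt Q (Q' r) r) :
    ∫ x, (Q (v x) * ⟪V x, gradient φ x⟫ + Q (v x) * diverg V x * φ x
      + Q' (v x) * ⟪gradient v x, V x⟫ * φ x) = 0 := by
  have hVi (i : Fin d) : ContDiff ℝ 1 fun x => V x i :=
    (EuclideanSpace.proj i : Euc d →L[ℝ] ℝ).contDiff.comp hV
  have hG (i : Fin d) : ContDiff ℝ 1 fun x => Q (v x) * V x i * φ x :=
    ((hQ.comp hv).mul (hVi i)).mul hφ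
  have hGc (i : Fin d) : HasCompactSupport fun x => Q (v x) * V x i * φ x := hφc.mul_left
  calc _ = ∫ x, ∑ i, fderiv ℝ (fun x => Q (v x) * V x i * φ x) x
        (EuclideanSpace.single i 1) := by
        congr 1 with x
        rw [real_inner_comm, inner_eq_sum_fderiv, inner_eq_sum_fderiv,
          diverg_eq_sum (hV.differentiable one_ne_zero x)]
        simp only [Finset.mul_sum, Finset.sum_mul, ← Finset.sum_add_distrib]
        refine Finset.sum_congr rfl fun i _ => ?_
        have h1 := (hQ' (v x)).comp_hasFDerivAt x (hv.differentiable one_ne_zero x).hasFDerivAt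
        have h2 := ((hVi i).differentiable one_ne_zero x).hasFDerivAt
        have h3 := (hφ.differentiable one_ne_zero x).hasFDerivAt
        have h4 : HasFDerivAt (fun x => Q (v x) * V x i * φ x) _ x := (h1.mul h2).mul h3
        rw [h4.fderiv]
        simp
        ring
    _ = ∑ i, ∫ x, fderiv ℝ (fun x => Q (v x) * V x i * φ x) x
        (EuclideanSpace.single i 1) := by
        refine integral_finsetSum _ fun i _ => ?_
        exact (((hG i).continuous_fderiv one_ne_zero).clm_apply
          continuous_const).integrable_of_hasCompactSupport ((hGc i).fderiv_apply ℝ _)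
    _ = 0 := Finset.sum_eq_zero fun i _ => integral_fderiv_apply_eq_zero (hG i) (hGc i) _

lemma contDiff_fderiv_apply {v : Euc d → ℝ} (hv : ContDiff ℝ 2 v) (e : Euc d) :
    ContDiff ℝ 1 fun x => fderiv ℝ v x e :=
  (hv.fderiv_right (m := 1) (by norm_num)).clm_apply contDiff_const

lemma continuous_lap {v : Euc d → ℝ} (hv : ContDiff ℝ 2 v) : Continuous (lap v) :=
  continuous_finsetSum _ fun _ _ =>
    ((contDiff_fderiv_apply hv _).continuous_fderiv one_ne_zero).clm_apply continuous_const

lemma lap_eq_zero_of_notMem_tsupport {v : Euc d → ℝ} {x : Euc d} (hx : x ∉ tsupport v) :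
    lap v x = 0 := by
  refine Finset.sum_eq_zero fun i _ => ?_
  have : (fun y => fderiv ℝ v y (EuclideanSpace.single i 1)) =ᶠ[𝓝 x] fun _ => 0 := by
    filter_upwards [(isClosed_tsupport v).isOpen_compl.mem_nhds hx] with y hy
    rw [fderiv_of_notMem_tsupport (𝕜 := ℝ) hy]
    rfl
  rw [this.fderiv_eq]
  simp

lemma integral_lap_nonneg {v φ : Euc d → ℝ} {E ψ : ℝ → ℝ}
    (hv : ContDiff ℝ 2 v) (hφ : ContDiff ℝ 2 φ) (hφc : HasCompactSupport φ) (hφ0 : ∀ x, 0 ≤ φ x)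
    (hE : ContDiff ℝ 1 E) (hE' : ∀ r, HasDerivAt E (ψ r) r) (hψ : ContDiff ℝ 1 ψ)
    (hψ' : ∀ r, 0 ≤ deriv ψ r) :
    0 ≤ ∫ x, (E (v x) * lap φ x - ψ (v x) * lap v x * φ x) := by
  have hv1 : ContDiff ℝ 1 v := hv.of_le (by norm_num)
  have hφ1 : ContDiff ℝ 1 φ := hφ.of_le (by norm_num)
  let e (i : Fin d) : Euc d := EuclideanSpace.single i 1
  let G (i : Fin d) (x : Euc d) : ℝ :=
    E (v x) * fderiv ℝ φ x (e i) - ψ (v x) * fderiv ℝ v x (e i) * φ x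
  have hG (i : Fin d) : ContDiff ℝ 1 (G i) :=
    ((hE.comp hv1).mul (contDiff_fderiv_apply hφ _)).sub
      (((hψ.comp hv1).mul (contDiff_fderiv_apply hv _)).mul hφ1)
  have hGc (i : Fin d) : HasCompactSupport (G i) :=
    (hφc.fderiv_apply ℝ (e i)).mul_left.sub hφc.mul_left
  have hGi (i : Fin d) : Integrable fun x => fderiv ℝ (G i) x (e i) :=
    (((hG i).continuous_fderiv one_ne_zero).clm_apply
      continuous_const).integrable_of_hasCompactSupport ((hGc i).fderiv_apply ℝ _)
  have hzero : ∫ x, ∑ i, fderiv ℝ (G i) x (e i) = 0 := by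
    rw [integral_finsetSum _ fun i _ => hGi i]
    exact Finset.sum_eq_zero fun i _ => integral_fderiv_apply_eq_zero (hG i) (hGc i) _
  rw [← hzero]
  refine integral_mono (integrable_finsetSum _ fun i _ => hGi i) ?_ fun x => ?_
  · have h1 := continuous_lap hv
    have h2 := continuous_lap hφ
    have h3 := hE.continuous
    have h4 := hψ.continuous
    have h5 := hv.continuous
    have h6 := hφ.continuous
    refine Continuous.integrable_of_hasCompactSupport (by fun_prop)
      (HasCompactSupport.intro hφc fun x hx => ?_)
    rw [lap_eq_zero_of_notMem_tsupport hx, image_eq_zero_of_notMem_tsupport hx]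
    simp
  · simp only [lap, Finset.mul_sum, Finset.sum_mul, ← Finset.sum_sub_distrib]
    refine Finset.sum_le_sum fun i _ => ?_
    have hvx := (hv1.differentiable one_ne_zero x).hasFDerivAt
    have h1 := (hE' (v x)).comp_hasFDerivAt x hvx
    have h2 := (hψ.differentiable one_ne_zero (v x)).hasDerivAt.comp_hasFDerivAt x hvx
    have h3 := (hφ1.differentiable one_ne_zero x).hasFDerivAt
    have h4 := ((contDiff_fderiv_apply hφ (e i)).differentiable one_ne_zero x).hasFDerivAt
    have h5 := ((contDiff_fderiv_apply hv (e i)).differentiable one_ne_zero x).hasFDerivAt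
    have h6 : HasFDerivAt (G i) _ x := (h1.mul h4).sub ((h2.mul h5).mul h3)
    have h7 := mul_nonneg (mul_nonneg (hψ' (v x)) (sq_nonneg (fderiv ℝ v x (e i)))) (hφ0 x)
    rw [h6.fderiv]
    simp [e] at h7 ⊢
    linarith

end Space

section Slice

variable {d : ℕ} {φ : ℝ → Euc d → ℝ}

lemma fderiv_slice {Ψ : ℝ × Euc d → ℝ} (hΨ : Differentiable ℝ Ψ) (p : ℝ × Euc d) :
    fderiv ℝ (fun y => Ψ (p.1, y)) p.2
      = (fderiv ℝ Ψ p).comp (ContinuousLinearMap.inr ℝ ℝ (Euc d)) :=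
  ((hΨ p).hasFDerivAt.comp p.2 (hasFDerivAt_prodMk_right p.1 p.2)).fderiv

lemma hasDerivAt_slice (hφ : Differentiable ℝ fun p : ℝ × Euc d => φ p.1 p.2) (p : ℝ × Euc d) :
    HasDerivAt (fun τ => φ τ p.2) (fderiv ℝ (fun p : ℝ × Euc d => φ p.1 p.2) p (1, 0)) p.1 := by
  have := ((hφ p).hasFDerivAt.comp p.1 (hasFDerivAt_prodMk_left p.1 p.2)).hasDerivAt
  rw [ContinuousLinearMap.comp_apply, ContinuousLinearMap.inl_apply] at this
  exact this

lemma continuous_deriv_slice (hφ : ContDiff ℝ 2 fun p : ℝ × Euc d => φ p.1 p.2) :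
    Continuous fun p : ℝ × Euc d => deriv (fun τ => φ τ p.2) p.1 := by
  rw [funext fun p => (hasDerivAt_slice (hφ.differentiable two_ne_zero) p).deriv]
  exact (hφ.continuous_fderiv two_ne_zero).clm_apply continuous_const

lemma continuous_gradient_slice (hφ : ContDiff ℝ 2 fun p : ℝ × Euc d => φ p.1 p.2) :
    Continuous fun p : ℝ × Euc d => gradient (φ p.1) p.2 := by
  refine (InnerProductSpace.toDual ℝ (Euc d)).symm.continuous.comp ?_
  have h : (fun p : ℝ × Euc d => fderiv ℝ (φ p.1) p.2) = _ :=
    funext fun p => fderiv_slice (hφ.differentiable two_ne_zero) p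
  rw [h]
  exact (hφ.continuous_fderiv two_ne_zero).clm_comp continuous_const

lemma continuous_lap_slice (hφ : ContDiff ℝ 2 fun p : ℝ × Euc d => φ p.1 p.2) :
    Continuous fun p : ℝ × Euc d => lap (φ p.1) p.2 := by
  refine continuous_finsetSum _ fun i _ => ?_
  let Ψ (p : ℝ × Euc d) : ℝ :=
    fderiv ℝ (fun p : ℝ × Euc d => φ p.1 p.2) p (0, EuclideanSpace.single i 1)
  have hΨ : ContDiff ℝ 1 Ψ := (hφ.fderiv_right (m := 1) (by norm_num)).clm_apply contDiff_const
  have h1 (t : ℝ) (y : Euc d) : fderiv ℝ (φ t) y (EuclideanSpace.single i 1) = Ψ (t, y) := by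
    have h : fderiv ℝ (φ t) y = _ := fderiv_slice (hφ.differentiable two_ne_zero) (t, y)
    rw [h]
    simp [Ψ]
  simp only [h1, fderiv_slice (hΨ.differentiable one_ne_zero)]
  exact ((hΨ.continuous_fderiv one_ne_zero).clm_comp continuous_const).clm_apply continuous_const

lemma notMem_tsupport_slice {t : ℝ} {x : Euc d}
    (h : (t, x) ∉ tsupport fun p : ℝ × Euc d => φ p.1 p.2) : x ∉ tsupport (φ t) := by
  have hc : IsClosed ((fun y => (t, y)) ⁻¹' tsupport fun p : ℝ × Euc d => φ p.1 p.2) :=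
    (isClosed_tsupport _).preimage (by fun_prop)
  have hs : Function.support (φ t) ⊆
      (fun y => (t, y)) ⁻¹' tsupport fun p : ℝ × Euc d => φ p.1 p.2 :=
    fun y (hy : φ t y ≠ 0) =>
      subset_tsupport (fun p : ℝ × Euc d => φ p.1 p.2) (show (t, y) ∈ Function.support _ from hy)
  exact fun hx => h (closure_minimal hs hc hx)

lemma gradient_slice_eq_zero {p : ℝ × Euc d}
    (h : p ∉ tsupport fun p : ℝ × Euc d => φ p.1 p.2) : gradient (φ p.1) p.2 = 0 := by
  rw [gradient, fderiv_of_notMem_tsupport (𝕜 := ℝ) (notMem_tsupport_slice h), map_zero]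

lemma eventually_slice_eq_zero {p : ℝ × Euc d}
    (h : p ∉ tsupport fun p : ℝ × Euc d => φ p.1 p.2) : ∀ᶠ τ in 𝓝 p.1, φ τ p.2 = 0 := by
  have hc : Continuous fun τ : ℝ => (τ, p.2) := by fun_prop
  filter_upwards [hc.continuousAt.preimage_mem_nhds
    ((isClosed_tsupport _).isOpen_compl.mem_nhds h)] with τ hτ
  exact image_eq_zero_of_notMem_tsupport (f := fun p : ℝ × Euc d => φ p.1 p.2) hτ

lemma deriv_slice_eq_zero {p : ℝ × Euc d}
    (h : p ∉ tsupport fun p : ℝ × Euc d => φ p.1 p.2) : deriv (fun τ => φ τ p.2) p.1 = 0 := by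
  have : (fun τ => φ τ p.2) =ᶠ[𝓝 p.1] fun _ => 0 := eventually_slice_eq_zero h
  rw [this.deriv_eq, deriv_const]

lemma hasCompactSupport_slice (hφc : HasCompactSupport fun p : ℝ × Euc d => φ p.1 p.2) (t : ℝ) :
    HasCompactSupport (φ t) := by
  refine HasCompactSupport.intro (hφc.isCompact.image continuous_snd) fun x hx => ?_
  exact image_eq_zero_of_notMem_tsupport (f := fun p : ℝ × Euc d => φ p.1 p.2) (x := (t, x))
    fun h => hx ⟨_, h, rfl⟩

lemma contDiff_slice (hφ : ContDiff ℝ 2 fun p : ℝ × Euc d => φ p.1 p.2) (t : ℝ) :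
    ContDiff ℝ 2 (φ t) :=
  hφ.comp (contDiff_const.prodMk contDiff_id : ContDiff ℝ 2 fun x : Euc d => (t, x))

lemma continuousOn_of_partial {T : ℝ} {u ut : ℝ → Euc d → ℝ}
    (hut : ∀ t ∈ Set.Ioo (0:ℝ) T, ∀ x, HasDerivAt (fun τ => u τ x) (ut t x) t)
    (hutc : ContinuousOn (fun p : ℝ × Euc d => ut p.1 p.2) (Set.Ioo 0 T ×ˢ Set.univ))
    (hux : ∀ t ∈ Set.Ioo (0:ℝ) T, Differentiable ℝ (u t))
    (hgradc : ContinuousOn (fun p : ℝ × Euc d => gradient (u p.1) p.2)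
      (Set.Ioo 0 T ×ˢ Set.univ)) :
    ContinuousOn (fun p : ℝ × Euc d => u p.1 p.2) (Set.Ioo 0 T ×ˢ Set.univ) := by
  have hO : IsOpen (Set.Ioo 0 T ×ˢ (Set.univ : Set (Euc d))) := isOpen_Ioo.prod isOpen_univ
  intro p hp
  have hnhds := hO.mem_nhds hp
  have := hasStrictFDerivAt_uncurry_coprod (𝕜 := ℝ) (u := p) (f := u)
    (f₁ := fun t x => ContinuousLinearMap.toSpanSingleton ℝ (ut t x))
    (f₂ := fun t x => InnerProductSpace.toDual ℝ (Euc d) (gradient (u t) x)) ?_ ?_ ?_ ?_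
  · exact this.hasFDerivAt.continuousAt.continuousWithinAt
  · filter_upwards [hnhds] with q hq
    exact (hut q.1 hq.1 q.2).hasFDerivAt
  · filter_upwards [hnhds] with q hq
    exact ((hux q.1 hq.1 q.2).hasGradientAt).hasFDerivAt
  · exact (ContinuousLinearMap.toSpanSingletonCLE (𝕜 := ℝ) (E := ℝ)).continuous.continuousAt.comp
      (hutc.continuousAt hnhds)
  · exact (InnerProductSpace.toDual ℝ (Euc d)).continuous.continuousAt.comp
      (hgradc.continuousAt hnhds)

end Slice

theorem stmt_9 (d : ℕ) (hd : 1 ≤ d) (T : ℝ) (hT : 0 < T) (ε : ℝ) (hε : 0 ≤ ε)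
    (k : ℝ) (f : ℝ → ℝ) (hf : ContDiff ℝ 1 f)
    (W : ℝ → Euc d → Euc d)
    (hWc : ContinuousOn (fun p : ℝ × Euc d => W p.1 p.2) (Set.Ioo 0 T ×ˢ Set.univ))
    (hWx : ∀ t ∈ Set.Ioo (0:ℝ) T, ContDiff ℝ 1 (W t))
    (hdivWc : ContinuousOn (fun p : ℝ × Euc d => diverg (W p.1) p.2)
      (Set.Ioo 0 T ×ˢ Set.univ))
    (u ut : ℝ → Euc d → ℝ)
    (hut : ∀ t ∈ Set.Ioo (0:ℝ) T, ∀ x, HasDerivAt (fun τ => u τ x) (ut t x) t)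
    (hutc : ContinuousOn (fun p : ℝ × Euc d => ut p.1 p.2) (Set.Ioo 0 T ×ˢ Set.univ))
    (hux : ∀ t ∈ Set.Ioo (0:ℝ) T, ContDiff ℝ 2 (u t))
    (hgradc : ContinuousOn (fun p : ℝ × Euc d => gradient (u p.1) p.2)
      (Set.Ioo 0 T ×ˢ Set.univ))
    (hlapc : ContinuousOn (fun p : ℝ × Euc d => lap (u p.1) p.2)
      (Set.Ioo 0 T ×ˢ Set.univ))
    (hPDE : ∀ t ∈ Set.Ioo (0:ℝ) T, ∀ x,
      ut t x + deriv f (u t x) * ⟪gradient (u t) x, W t x⟫ + f (u t x) * diverg (W t) x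
        = ε * lap (u t) x)
    (φ : ℝ → Euc d → ℝ)
    (hφ : ContDiff ℝ 2 (fun p : ℝ × Euc d => φ p.1 p.2))
    (hφc : HasCompactSupport (fun p : ℝ × Euc d => φ p.1 p.2))
    (hφsupp : tsupport (fun p : ℝ × Euc d => φ p.1 p.2) ⊆ Set.Ioo 0 T ×ˢ Set.univ)
    (hφ0 : ∀ t x, 0 ≤ φ t x) :
    0 ≤ ∫ t in Set.Ioo (0:ℝ) T, ∫ x,
        (|u t x - k| * deriv (fun τ => φ τ x) t
          + Real.sign (u t x - k) * (f (u t x) - f k) * ⟪W t x, gradient (φ t) x⟫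
          - Real.sign (u t x - k) * f k * diverg (W t) x * φ t x
          + ε * |u t x - k| * lap (φ t) x) := by
  have hΦ1 := hφ.differentiable two_ne_zero
  set O : Set (ℝ × Euc d) := Set.Ioo 0 T ×ˢ Set.univ
  set K : Set (ℝ × Euc d) := tsupport fun p : ℝ × Euc d => φ p.1 p.2
  have hO : IsOpen O := isOpen_Ioo.prod isOpen_univ
  have hK : IsCompact K := hφc
  have huc : ContinuousOn (fun p : ℝ × Euc d => u p.1 p.2) O :=
    continuousOn_of_partial hut hutc (fun t ht => (hux t ht).differentiable two_ne_zero) hgradc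
  have hφ0K (p : ℝ × Euc d) (hp : p ∉ K) : φ p.1 p.2 = 0 :=
    image_eq_zero_of_notMem_tsupport (f := fun p : ℝ × Euc d => φ p.1 p.2) hp
  have hφtK (p : ℝ × Euc d) (hp : p ∉ K) : deriv (fun τ => φ τ p.2) p.1 = 0 :=
    deriv_slice_eq_zero hp
  have hWgK (p : ℝ × Euc d) (hp : p ∉ K) : ⟪W p.1 p.2, gradient (φ p.1) p.2⟫ = 0 := by
    rw [gradient_slice_eq_zero hp, inner_zero_right]
  have hφlK (p : ℝ × Euc d) (hp : p ∉ K) : lap (φ p.1) p.2 = 0 :=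
    lap_eq_zero_of_notMem_tsupport (notMem_tsupport_slice hp)
  have cφ : ContinuousOn (fun p : ℝ × Euc d => φ p.1 p.2) O := hφ.continuous.continuousOn
  have cφt := (continuous_deriv_slice hφ).continuousOn (s := O)
  have cφl := (continuous_lap_slice hφ).continuousOn (s := O)
  have cWg : ContinuousOn (fun p : ℝ × Euc d => ⟪W p.1 p.2, gradient (φ p.1) p.2⟫) O :=
    hWc.inner (continuous_gradient_slice hφ).continuousOn
  have cuW : ContinuousOn (fun p : ℝ × Euc d => ⟪gradient (u p.1) p.2, W p.1 p.2⟫) O :=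
    hgradc.inner hWc
  have hcont {h : ℝ × Euc d → ℝ} (hc : ContinuousOn h O) (h0 : ∀ p ∉ K, h p = 0) :
      Continuous h :=
    continuous_of_continuousOn_of_eq_zero hO hK.isClosed hφsupp hc h0
  have hint {h : ℝ × Euc d → ℝ} (hc : ContinuousOn h O) (h0 : ∀ p ∉ K, h p = 0) :
      Integrable h :=
    (hcont hc h0).integrable_of_hasCompactSupport (HasCompactSupport.intro hK h0)
  have hcomp {g : ℝ → ℝ} (hg : Continuous g) :
      ContinuousOn (fun p : ℝ × Euc d => g (u p.1 p.2)) O := hg.comp_continuousOn huc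
  have hf' : Continuous (deriv f) := hf.continuous_deriv le_rfl
  have c1 : Continuous fun _ : ℝ => (1 : ℝ) := continuous_const
  let ψ (n : ℕ) (r : ℝ) : ℝ := smoothSign n (r - k)
  have cψ (n : ℕ) : ContDiff ℝ 1 (ψ n) :=
    (contDiff_smoothSign n).comp (contDiff_id.sub contDiff_const)
  have hψ' (n : ℕ) (r : ℝ) : 0 ≤ deriv (ψ n) r := by
    have := deriv_comp_sub_const (f := smoothSign n) k r
    simp only [ψ, this, deriv_smoothSign_nonneg]
  let E : ℕ → ℝ → ℝ := smoothFlux k fun _ => 1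
  have cE (n : ℕ) : ContDiff ℝ 1 (E n) := contDiff_smoothFlux k c1 n
  have hE' (n : ℕ) (r : ℝ) : HasDerivAt (E n) (ψ n r) r := by
    simpa using hasDerivAt_smoothFlux k c1 n r
  let Q : ℕ → ℝ → ℝ := smoothFlux k (deriv f)
  have cQ (n : ℕ) : ContDiff ℝ 1 (Q n) := contDiff_smoothFlux k hf' n
  have hQ' (n : ℕ) (r : ℝ) : HasDerivAt (Q n) (ψ n r * deriv f r) r :=
    hasDerivAt_smoothFlux k hf' n r
  let A (n : ℕ) (p : ℝ × Euc d) : ℝ :=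
    E n (u p.1 p.2) * deriv (fun τ => φ τ p.2) p.1 + ψ n (u p.1 p.2) * ut p.1 p.2 * φ p.1 p.2
  have hA (n : ℕ) : Integrable (A n) ∧ ∫ p, A n p = 0 := by
    have c0 (p : ℝ × Euc d) (hp : p ∉ K) : A n p = 0 := by
      simp only [A, hφ0K p hp, hφtK p hp, mul_zero, add_zero]
    have cc : ContinuousOn (A n) O :=
      ((hcomp (cE n).continuous).mul cφt).add (((hcomp (cψ n).continuous).mul hutc).mul cφ)
    have cc' : ContinuousOn (fun p : ℝ × Euc d => E n (u p.1 p.2) * φ p.1 p.2) O :=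
      (hcomp (cE n).continuous).mul cφ
    have c0' : ∀ p ∉ K, E n (u p.1 p.2) * φ p.1 p.2 = 0 := fun p hp => by
      rw [hφ0K p hp, mul_zero]
    refine ⟨hint cc c0, ?_⟩
    rw [Measure.volume_eq_prod, integral_prod_symm _ (hint cc c0)]
    refine integral_eq_zero_of_ae (Eventually.of_forall fun x => ?_)
    refine integral_eq_zero_of_hasDerivAt_of_integrable (f := fun t => E n (u t x) * φ t x)
      (fun t => ?_) (integrable_slice_left hK (hcont cc c0) c0 x)
      (integrable_slice_left hK (hcont cc' c0') c0' x)
    by_cases hp : (t, x) ∈ K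
    · have h1 := (hE' n (u t x)).comp t (hut t (hφsupp hp).1 x)
      have h2 : HasDerivAt (fun τ => φ τ x) (deriv (fun τ => φ τ x) t) t :=
        (hasDerivAt_slice hΦ1 (t, x)).differentiableAt.hasDerivAt
      exact (h1.mul h2).congr_deriv (add_comm _ _)
    · rw [c0 _ hp]
      have : (fun t => E n (u t x) * φ t x) =ᶠ[𝓝 t] fun _ => 0 := by
        filter_upwards [eventually_slice_eq_zero hp] with τ hτ
        rw [hτ, mul_zero]
      exact (hasDerivAt_const t (0 : ℝ)).congr_of_eventuallyEq this
  let B (n : ℕ) (p : ℝ × Euc d) : ℝ :=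
    Q n (u p.1 p.2) * ⟪W p.1 p.2, gradient (φ p.1) p.2⟫
      + Q n (u p.1 p.2) * diverg (W p.1) p.2 * φ p.1 p.2
      + ψ n (u p.1 p.2) * deriv f (u p.1 p.2) * ⟪gradient (u p.1) p.2, W p.1 p.2⟫ * φ p.1 p.2
  have hB (n : ℕ) : Integrable (B n) ∧ ∫ p, B n p = 0 := by
    have c0 (p : ℝ × Euc d) (hp : p ∉ K) : B n p = 0 := by
      simp only [B, hφ0K p hp, hWgK p hp, mul_zero, add_zero]
    have hi : Integrable (B n) := hint ((((hcomp (cQ n).continuous).mul cWg).add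
      (((hcomp (cQ n).continuous).mul hdivWc).mul cφ)).add
      ((((hcomp (cψ n).continuous).mul (hcomp hf')).mul cuW).mul cφ)) c0
    refine ⟨hi, ?_⟩
    rw [Measure.volume_eq_prod, integral_prod _ hi]
    refine integral_eq_zero_of_ae (Eventually.of_forall fun t => ?_)
    by_cases ht : t ∈ Set.Ioo 0 T
    · have hu1 : ContDiff ℝ 1 (u t) := (hux t ht).of_le (by norm_num)
      have hφ1 : ContDiff ℝ 1 (φ t) := (contDiff_slice hφ t).of_le (by norm_num)
      have h := integral_flux_eq_zero hu1 hφ1 (hasCompactSupport_slice hφc t) (hWx t ht)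
        (cQ n) (hQ' n)
      exact h
    · exact integral_eq_zero_of_ae
        (Eventually.of_forall fun x => c0 (t, x) fun h => ht (hφsupp h).1)
  let C (n : ℕ) (p : ℝ × Euc d) : ℝ :=
    E n (u p.1 p.2) * lap (φ p.1) p.2 - ψ n (u p.1 p.2) * lap (u p.1) p.2 * φ p.1 p.2
  have hC (n : ℕ) : Integrable (C n) ∧ 0 ≤ ∫ p, C n p := by
    have c0 (p : ℝ × Euc d) (hp : p ∉ K) : C n p = 0 := by
      simp only [C, hφ0K p hp, hφlK p hp, mul_zero, sub_zero]
    have hi : Integrable (C n) := hint (((hcomp (cE n).continuous).mul cφl).sub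
      (((hcomp (cψ n).continuous).mul hlapc).mul cφ)) c0
    refine ⟨hi, ?_⟩
    rw [Measure.volume_eq_prod, integral_prod _ hi]
    refine integral_nonneg fun t => ?_
    by_cases ht : t ∈ Set.Ioo 0 T
    · have h := integral_lap_nonneg (hux t ht) (contDiff_slice hφ t)
        (hasCompactSupport_slice hφc t) (hφ0 t) (cE n) (hE' n) (cψ n) (hψ' n)
      exact h
    · exact (integral_eq_zero_of_ae
        (Eventually.of_forall fun x => c0 (t, x) fun h => ht (hφsupp h).1)).ge
  let F (n : ℕ) (p : ℝ × Euc d) : ℝ :=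
    E n (u p.1 p.2) * deriv (fun τ => φ τ p.2) p.1
      + Q n (u p.1 p.2) * ⟪W p.1 p.2, gradient (φ p.1) p.2⟫
      - (ψ n (u p.1 p.2) * f (u p.1 p.2) - Q n (u p.1 p.2)) * diverg (W p.1) p.2 * φ p.1 p.2
      + ε * E n (u p.1 p.2) * lap (φ p.1) p.2
  have hF (n : ℕ) : 0 ≤ ∫ p, F n p := by
    have hFeq : F n = fun p => A n p + B n p + ε * C n p := by
      funext p
      by_cases hp : p ∈ K
      · simp only [F, A, B, C]
        linear_combination (-(ψ n (u p.1 p.2) * φ p.1 p.2)) * hPDE p.1 (hφsupp hp).1 p.2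
      · simp only [F, A, B, C, hφ0K p hp]
        ring
    have hAB : Integrable fun p => A n p + B n p := (hA n).1.add (hB n).1
    rw [hFeq]
    rw [integral_add hAB ((hC n).1.const_mul ε),
      integral_add (hA n).1 (hB n).1, (hA n).2, (hB n).2, integral_const_mul]
    have := mul_nonneg hε (hC n).2
    linarith
  let G (p : ℝ × Euc d) : ℝ :=
    |u p.1 p.2 - k| * deriv (fun τ => φ τ p.2) p.1
      + Real.sign (u p.1 p.2 - k) * (f (u p.1 p.2) - f k) * ⟪W p.1 p.2, gradient (φ p.1) p.2⟫
      - Real.sign (u p.1 p.2 - k) * f k * diverg (W p.1) p.2 * φ p.1 p.2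
      + ε * |u p.1 p.2 - k| * lap (φ p.1) p.2
  have hFlim (p : ℝ × Euc d) : Tendsto (fun n => F n p) atTop (𝓝 (G p)) := by
    have lE : Tendsto (fun n => E n (u p.1 p.2)) atTop (𝓝 |u p.1 p.2 - k|) := by
      have h := tendsto_smoothFlux k c1 (u p.1 p.2)
      rwa [intervalIntegral.integral_const, smul_eq_mul, mul_one,
        sign_mul_self_eq_abs] at h
    have lQ : Tendsto (fun n => Q n (u p.1 p.2)) atTop
        (𝓝 (Real.sign (u p.1 p.2 - k) * (f (u p.1 p.2) - f k))) := by
      have h := tendsto_smoothFlux k hf' (u p.1 p.2)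
      rwa [intervalIntegral.integral_deriv_eq_sub
        (fun x _ => hf.differentiable one_ne_zero x) (hf'.intervalIntegrable _ _)] at h
    have lψ : Tendsto (fun n => ψ n (u p.1 p.2)) atTop (𝓝 (Real.sign (u p.1 p.2 - k))) :=
      tendsto_smoothSign _
    convert (((lE.mul_const (deriv (fun τ => φ τ p.2) p.1)).add
      (lQ.mul_const ⟪W p.1 p.2, gradient (φ p.1) p.2⟫)).sub
      ((((lψ.mul_const (f (u p.1 p.2))).sub lQ).mul_const (diverg (W p.1) p.2)).mul_const
        (φ p.1 p.2))).add ((lE.const_mul ε).mul_const (lap (φ p.1) p.2)) using 2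
    simp only [G]
    ring
  let M (g : ℝ → ℝ) (r : ℝ) : ℝ := |(∫ s in k..r, |g s|)|
  let D (p : ℝ × Euc d) : ℝ :=
    M (fun _ => 1) (u p.1 p.2) * |deriv (fun τ => φ τ p.2) p.1|
      + M (deriv f) (u p.1 p.2) * |⟪W p.1 p.2, gradient (φ p.1) p.2⟫|
      + (1 * |f (u p.1 p.2)| + M (deriv f) (u p.1 p.2)) * |diverg (W p.1) p.2| * |φ p.1 p.2|
      + |ε| * M (fun _ => 1) (u p.1 p.2) * |lap (φ p.1) p.2|
  have hD : Integrable D := by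
    have cM1 := hcomp (continuous_abs_primitive k c1)
    have cM2 := hcomp (continuous_abs_primitive k hf')
    refine hint ?_ fun p hp => ?_
    · exact (((cM1.mul cφt.abs).add (cM2.mul cWg.abs)).add
        ((((continuousOn_const.mul (hcomp hf.continuous).abs).add cM2).mul hdivWc.abs).mul
          cφ.abs)).add ((continuousOn_const.mul cM1).mul cφl.abs)
    · simp only [D, hφ0K p hp, hφtK p hp, hWgK p hp, hφlK p hp, abs_zero, mul_zero, add_zero]
  have hFD (n : ℕ) (p : ℝ × Euc d) : ‖F n p‖ ≤ D p := by
    have bE : |E n (u p.1 p.2)| ≤ M (fun _ => 1) (u p.1 p.2) := abs_smoothFlux_le k c1 n _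
    have bQ : |Q n (u p.1 p.2)| ≤ M (deriv f) (u p.1 p.2) := abs_smoothFlux_le k hf' n _
    have bψ : |ψ n (u p.1 p.2)| ≤ 1 := abs_smoothSign_le n _
    refine (norm_add_le _ _).trans (add_le_add ((norm_sub_le _ _).trans
      (add_le_add ((norm_add_le _ _).trans (add_le_add ?_ ?_)) ?_)) ?_)
    · rw [norm_eq_abs, abs_mul]
      gcongr
    · rw [norm_eq_abs, abs_mul]
      gcongr
    · rw [norm_eq_abs, abs_mul, abs_mul]
      gcongr
      refine (abs_sub _ _).trans ?_
      rw [abs_mul]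
      gcongr
    · rw [norm_eq_abs, abs_mul, abs_mul]
      gcongr
  have hFm (n : ℕ) : AEStronglyMeasurable (F n) := by
    refine (hint ?_ fun p hp => ?_).aestronglyMeasurable
    · have e1 := hcomp (cE n).continuous
      have e2 := hcomp (cQ n).continuous
      have e3 := hcomp (cψ n).continuous
      exact (((e1.mul cφt).add (e2.mul cWg)).sub
        ((((e3.mul (hcomp hf.continuous)).sub e2).mul hdivWc).mul cφ)).add
        ((continuousOn_const.mul e1).mul cφl)
    · simp only [F, hφ0K p hp, hφtK p hp, hWgK p hp, hφlK p hp, mul_zero, add_zero, sub_zero]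
  have hG : Integrable G := by
    refine hD.mono' (aestronglyMeasurable_of_tendsto_ae atTop hFm
      (Eventually.of_forall hFlim)) (Eventually.of_forall fun p => ?_)
    exact le_of_tendsto (hFlim p).norm (Eventually.of_forall fun n => hFD n p)
  have hG0 : 0 ≤ ∫ p, G p :=
    ge_of_tendsto' (tendsto_integral_of_dominated_convergence D hFm hD
      (fun n => Eventually.of_forall (hFD n)) (Eventually.of_forall hFlim)) hF
  rw [Measure.volume_eq_prod, integral_prod _ hG] at hG0
  rw [setIntegral_eq_integral_of_forall_compl_eq_zero]
  · exact hG0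
  · intro t ht
    refine integral_eq_zero_of_ae (Eventually.of_forall fun x => ?_)
    have hp : (t, x) ∉ K := fun h => ht (hφsupp h).1
    have h : G (t, x) = 0 := by
      simp only [G, hφ0K _ hp, hφtK _ hp, hWgK _ hp, hφlK _ hp, mul_zero, add_zero, sub_zero]
    exact h
end
end
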